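/- Fix μ > 0, let g : ℝ → ℝ be Bohr almost periodic with inf g > 0, and let (ũ, h̃) be an almost periodic semi-wave solution of (FBP_g) connecting u*_g and 0, with profile v(ξ, τ) = ũ(ξ + τ, h̃⁻¹(τ)). Define f : ℝ → ℝ by f(τ) := −μ v_ξ(0, τ). Then: (i) h̃'(t) = f(h̃(t)) for every t ∈ ℝ; (ii) f is Bohr almost periodic with inf_{τ ∈ ℝ} f(τ) > 0 and sup_{τ ∈ ℝ} f(τ) < ∞; and (iii) the average speed exists: the limit c := lim_{s − r → +∞} (s − r) / ∫_r^s (1/f(τ)) dτ exists and lies in (0, ∞). -/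

import Mathlib

/-- A function `f : ℝ → ℝ` is Bohr almost periodic if for every `ε > 0` there is `L > 0`
such that every interval of length `L` contains an `ε`-almost period `s`. -/
def BohrAlmostPeriodic (f : ℝ → ℝ) : Prop :=
  ∀ ε > (0 : ℝ), ∃ L > (0 : ℝ), ∀ t : ℝ, ∃ s ∈ Set.Icc t (t + L),
    ∀ x : ℝ, |f (x + s) - f x| < ε

/-- `u` is a bounded positive C² solution of `u'' + u (g x - u) = 0` on `ℝ`. -/
def IsBddPosSteadyState (g u : ℝ → ℝ) : Prop :=
  ContDiff ℝ 2 u ∧ (∃ C : ℝ, ∀ x : ℝ, |u x| ≤ C) ∧ (∀ x : ℝ, 0 < u x) ∧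
    ∀ x : ℝ, deriv (deriv u) x + u x * (g x - u x) = 0

/-- `(u, h)` is a classical solution of the free boundary problem
`u_t = u_xx + u (g x - u)` for `x < h t`, `u (h t) t = 0`, `h' t = -μ u_x (h t) t`,
for times `t` in the set `J`. -/
structure IsFBPSol (μ : ℝ) (g : ℝ → ℝ) (J : Set ℝ) (u : ℝ → ℝ → ℝ) (h : ℝ → ℝ) : Prop where
  h_diff : ∀ t ∈ J, DifferentiableAt ℝ h t
  h_deriv_cont : ContinuousOn (deriv h) J
  u_cont : ContinuousOn (fun p : ℝ × ℝ => u p.1 p.2) {p : ℝ × ℝ | p.2 ∈ J ∧ p.1 ≤ h p.2}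
  u_reg_x : ∀ t ∈ J, ∀ x < h t, DifferentiableAt ℝ (fun y => u y t) x ∧
      DifferentiableAt ℝ (deriv fun y => u y t) x
  u_reg_t : ∀ t ∈ J, ∀ x < h t, DifferentiableAt ℝ (fun s => u x s) t
  pde : ∀ t ∈ J, ∀ x < h t,
      deriv (fun s => u x s) t = deriv (deriv fun y => u y t) x + u x t * (g x - u x t)
  bdry : ∀ t ∈ J, u (h t) t = 0
  stefan : ∀ t ∈ J, deriv h t = -μ * deriv (fun y => u y t) (h t)

/-- The profile `v (ξ, τ) = u (ξ + τ, h⁻¹ τ)` of a solution with strictly monotone front `h`. -/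
noncomputable def profile (u : ℝ → ℝ → ℝ) (h : ℝ → ℝ) (ξ τ : ℝ) : ℝ :=
  u (ξ + τ) (Function.invFun h τ)

/-- `(u, h)` is an almost periodic semi-wave solution of the free boundary problem
connecting the steady state `ustar` and `0`. -/
structure IsAPSemiWave (μ : ℝ) (g ustar : ℝ → ℝ) (u : ℝ → ℝ → ℝ) (h : ℝ → ℝ) : Prop where
  sol : IsFBPSol μ g Set.univ u h
  bdd : ∃ C : ℝ, ∀ x t : ℝ, |u x t| ≤ C
  pos : ∀ t : ℝ, ∀ x < h t, 0 < u x t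
  mono : StrictMono h
  tendsto_top : Filter.Tendsto h Filter.atTop Filter.atTop
  tendsto_bot : Filter.Tendsto h Filter.atBot Filter.atBot
  almost_periodic : ∀ ε > (0 : ℝ), ∃ L > (0 : ℝ), ∀ r : ℝ, ∃ s ∈ Set.Icc r (r + L),
      ∀ ξ ≤ (0 : ℝ), ∀ τ : ℝ, |profile u h ξ (τ + s) - profile u h ξ τ| < ε
  connects : ∀ ε > (0 : ℝ), ∃ X : ℝ, ∀ ξ ≤ X, ∀ τ : ℝ,
      |profile u h ξ τ - ustar (ξ + τ)| < ε

open Filter Topology Set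

/-- Necessary second-order condition at a local maximum. -/
lemma second_deriv_nonpos_of_isLocalMax {f f' : ℝ → ℝ} {x c : ℝ}
    (hf : ∀ᶠ y in 𝓝 x, HasDerivAt f (f' y) y) (hf' : HasDerivAt f' c x)
    (hmax : IsLocalMax f x) : c ≤ 0 := by
  by_contra! hc
  have h1 : deriv f =ᶠ[𝓝 x] f' := hf.mono fun y hy => hy.deriv
  have h2 : deriv (deriv f) x = c := by rw [h1.deriv_eq, hf'.deriv]
  have hmin : IsLocalMin f x := isLocalMin_of_deriv_deriv_pos (by rwa [h2])
    (by rw [hf.self_of_nhds.deriv]; exact hmax.hasDerivAt_eq_zero hf.self_of_nhds)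
    hf.self_of_nhds.continuousAt
  have hconst : f =ᶠ[𝓝 x] fun _ => f x := by
    filter_upwards [hmin, hmax] with y h3 h4 using le_antisymm h4 h3
  have h5 : deriv f =ᶠ[𝓝 x] fun _ => 0 := by
    filter_upwards [hconst.eventuallyEq_nhds] with y hy
    rw [hy.deriv_eq]; simp
  rw [h5.deriv_eq] at h2
  simp at h2
  exact hc.ne h2

/-- A function attaining its maximum over the past at `t` has nonnegative derivative at `t`. -/
lemma deriv_nonneg_of_past_max {f : ℝ → ℝ} {t c : ℝ} (hf : HasDerivAt f c t)
    (hmax : ∀ᶠ s in 𝓝[<] t, f s ≤ f t) : 0 ≤ c := by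
  have h1 := hf.hasDerivWithinAt (s := Iio t)
  rw [hasDerivWithinAt_iff_tendsto_slope' (by simp)] at h1
  refine ge_of_tendsto h1 ?_
  filter_upwards [hmax, self_mem_nhdsWithin] with s hs hst
  rw [slope_def_field]
  exact div_nonneg_of_nonpos (by linarith) (by linarith [mem_Iio.1 hst])

/-- A continuous function on a compact set is nonpositive if it has no positive maximum. -/
lemma nonpos_of_no_positive_max {X : Type*} [TopologicalSpace X] {S : Set X} (hS : IsCompact S)
    {Φ : X → ℝ} (hΦ : ContinuousOn Φ S)
    (hmax : ∀ p ∈ S, (∀ q ∈ S, Φ q ≤ Φ p) → 0 < Φ p → False) : ∀ p ∈ S, Φ p ≤ 0 := by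
  intro p hp
  obtain ⟨q, hq, hq'⟩ := hS.exists_isMaxOn ⟨p, hp⟩ hΦ
  by_contra! hpos
  exact hmax q hq (fun r hr => hq' hr) (hpos.trans_le (hq' hp))

/-- A bounded function `u` behind a nondecreasing front `h`, vanishing on the front and solving
the heat equation up to an error at most `F`. -/
structure HeatFront (u : ℝ → ℝ → ℝ) (h : ℝ → ℝ) (C F : ℝ) : Prop where
  mono : Monotone h
  diff : Differentiable ℝ h
  cont : ContinuousOn (fun p : ℝ × ℝ => u p.1 p.2) {p | p.1 ≤ h p.2}
  bdd : ∀ x t, |u x t| ≤ C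
  bdry : ∀ t, u (h t) t = 0
  reg_x : ∀ t, ∀ x < h t, DifferentiableAt ℝ (fun y => u y t) x
  reg_xx : ∀ t, ∀ x < h t, DifferentiableAt ℝ (deriv fun y => u y t) x
  reg_t : ∀ t, ∀ x < h t, DifferentiableAt ℝ (fun s => u x s) t
  pde : ∀ t, ∀ x < h t, |deriv (fun s => u x s) t - deriv (deriv fun y => u y t) x| ≤ F

namespace HeatFront

variable {u : ℝ → ℝ → ℝ} {h : ℝ → ℝ} {C F : ℝ}

lemma C_nonneg (H : HeatFront u h C F) : 0 ≤ C := (abs_nonneg _).trans (H.bdd 0 0)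

lemma F_nonneg (H : HeatFront u h C F) : 0 ≤ F :=
  (abs_nonneg _).trans (H.pde 0 (h 0 - 1) (by linarith))

lemma deriv_front_nonneg (H : HeatFront u h C F) (t : ℝ) : 0 ≤ deriv h t :=
  H.mono.deriv_nonneg

lemma neg (H : HeatFront u h C F) : HeatFront (fun x t => -u x t) h C F where
  mono := H.mono
  diff := H.diff
  cont := H.cont.neg
  bdd x t := by simpa using H.bdd x t
  bdry t := by simpa using H.bdry t
  reg_x t x hx := (H.reg_x t x hx).neg
  reg_xx t x hx := by
    rw [show (deriv fun y => -u y t) = fun y => -deriv (fun y => u y t) y from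
      funext fun y => deriv.fun_neg]
    exact (H.reg_xx t x hx).neg
  reg_t t x hx := (H.reg_t t x hx).neg
  pde t x hx := by
    rw [show (deriv fun y => -u y t) = fun y => -deriv (fun y => u y t) y from
      funext fun y => deriv.fun_neg, deriv.fun_neg, deriv.fun_neg, ← abs_neg]
    convert H.pde t x hx using 2
    ring

lemma eventually_hasDerivAt (H : HeatFront u h C F) {x t : ℝ} (hx : x < h t) :
    ∀ᶠ y in 𝓝 x, HasDerivAt (fun y => u y t) (deriv (fun y => u y t) y) y := by
  filter_upwards [eventually_lt_nhds hx] with y hy using (H.reg_x t y hy).hasDerivAt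

lemma isCompact_strip (H : HeatFront u h C F) (R t₀ T : ℝ) :
    IsCompact {p : ℝ × ℝ | (t₀ ≤ p.2 ∧ p.2 ≤ T) ∧ h p.2 - R ≤ p.1 ∧ p.1 ≤ h p.2} := by
  have hc := H.diff.continuous
  refine IsCompact.of_isClosed_subset
    ((isCompact_Icc (a := h t₀ - R) (b := h T)).prod (isCompact_Icc (a := t₀) (b := T))) ?_ ?_
  · simp only [ofPred_and]
    refine .inter (.inter ?_ ?_) (.inter ?_ ?_) <;> exact isClosed_le (by fun_prop) (by fun_prop)
  · rintro ⟨x, t⟩ ⟨⟨h1, h2⟩, h3, h4⟩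
    have := H.mono h1
    have := H.mono h2
    simp only [mem_prod, mem_Icc] at *
    exact ⟨⟨by linarith, by linarith⟩, h1, h2⟩

/-- Points strictly behind the front by less than `R` stay so for nearby earlier times. -/
lemma eventually_strip (H : HeatFront u h C F) {R t₀ T x t : ℝ} (h0 : t₀ < t) (hT : t ≤ T)
    (h1 : h t - R < x) (h2 : x < h t) :
    ∀ᶠ s in 𝓝[<] t, (t₀ ≤ s ∧ s ≤ T) ∧ h s - R ≤ x ∧ x ≤ h s := by
  have hc := H.diff.continuous.continuousAt (x := t)
  filter_upwards [self_mem_nhdsWithin, (eventually_gt_nhds h0).filter_mono nhdsWithin_le_nhds,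
    ((hc.sub_const R).eventually_lt_const h1).filter_mono nhdsWithin_le_nhds,
    (hc.eventually_const_lt h2).filter_mono nhdsWithin_le_nhds] with s h3 h4 h5 h6
  exact ⟨⟨h4.le, (mem_Iio.1 h3).le.trans hT⟩, h5.le, h6.le⟩

/-- Linear growth away from the front. -/
lemma le_linear (H : HeatFront u h C F) {x t : ℝ} (hx : x ≤ h t) :
    u x t ≤ 2 * (C + F + 1) * (h t - x) := by
  have hC := H.C_nonneg
  have hF := H.F_nonneg
  set A := C + F + 1 with hA
  rcases le_or_gt 1 (h t - x) with h1 | h1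
  · nlinarith [(abs_le.1 (H.bdd x t)).2]
  have hc := H.diff.continuous
  have key := nonpos_of_no_positive_max (H.isCompact_strip 1 (t - C) t)
    (Φ := fun p => u p.1 p.2 - A * (2 * (h p.2 - p.1) - (h p.2 - p.1) ^ 2) + (p.2 - t)) ?_ ?_
    (x, t) ⟨⟨by simpa using hC, le_rfl⟩, by simp; linarith, hx⟩
  · simp only [sub_self, add_zero] at key
    nlinarith [sq_nonneg (h t - x)]
  · exact ((H.cont.mono fun p hp => hp.2.2).sub (by fun_prop)).add (by fun_prop)
  rintro ⟨y, s⟩ ⟨⟨h2, h3⟩, h4, h5⟩ hmax hpos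
  simp only at h2 h3 h4 h5 hpos
  have hub := (abs_le.1 (H.bdd y s)).2
  have h2' : t - C < s := by
    refine lt_of_le_of_ne h2 fun he => ?_
    have : 0 ≤ A * ((h s - y) * (2 - (h s - y))) :=
      mul_nonneg (by linarith) (mul_nonneg (by linarith) (by linarith))
    nlinarith
  have h4' : h s - 1 < y := by
    refine lt_of_le_of_ne h4 fun he => ?_
    rw [show h s - y = 1 by linarith] at hpos
    nlinarith
  have h5' : y < h s := by
    refine lt_of_le_of_ne h5 fun he => ?_
    rw [he, H.bdry s] at hpos
    simp at hpos
    linarith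
  have ht := deriv_nonneg_of_past_max (t := s) (((H.reg_t s y h5').hasDerivAt.sub
    (((((H.diff s).hasDerivAt.sub_const y).const_mul 2).sub
      (((H.diff s).hasDerivAt.sub_const y).pow 2)).const_mul A)).add
        ((hasDerivAt_id s).sub_const t)) (by
    filter_upwards [H.eventually_strip h2' h3 h4' h5'] with r hr using hmax (y, r) hr)
  have hxx := second_deriv_nonpos_of_isLocalMax (x := y) (c := deriv (deriv fun z => u z s) y + 2 * A)
    (f := fun z => u z s - A * (2 * (h s - z) - (h s - z) ^ 2) + (s - t))
    (f' := fun z => deriv (fun z => u z s) z + A * (2 - 2 * (h s - z))) ?_ ?_ ?_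
  · have hp := (abs_le.1 (H.pde s y h5')).2
    have := H.deriv_front_nonneg s
    have : 0 ≤ A * ((1 - (h s - y)) * deriv h s) :=
      mul_nonneg (by linarith) (mul_nonneg (by linarith) this)
    simp at ht
    nlinarith
  · filter_upwards [H.eventually_hasDerivAt h5'] with z hz
    have h6 := (hasDerivAt_id' z).const_sub (h s)
    exact ((hz.sub (((h6.const_mul 2).sub (h6.pow 2)).const_mul A)).add_const
      (s - t)).congr_deriv (by simp; ring)
  · have h6 := (hasDerivAt_id' y).const_sub (h s)
    exact ((H.reg_xx s y h5').hasDerivAt.add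
      (((h6.const_mul 2).const_sub 2).const_mul A)).congr_deriv (by ring)
  · filter_upwards [eventually_gt_nhds h4', eventually_lt_nhds h5'] with z h6 h7
    exact hmax (z, s) ⟨⟨h2, h3⟩, h6.le, h7.le⟩

lemma continuousOn_comp (H : HeatFront u h C F) {X : Type*} [TopologicalSpace X] {S : Set X}
    {f g : X → ℝ} (hf : Continuous f) (hg : Continuous g) (hS : ∀ p ∈ S, f p ≤ h (g p)) :
    ContinuousOn (fun p => u (f p) (g p)) S :=
  H.cont.comp (f := fun p => (f p, g p)) (hf.prodMk hg).continuousOn hS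

/-- One-sided Lipschitz bound with a quadratic penalty at infinity. -/
lemma sub_le_aux (H : HeatFront u h C F) {ε x y t : ℝ} (hε : 0 < ε) (hε1 : ε ≤ 1)
    (hx : x ≤ h t) (hy : y ≤ x) (hxy : x - 1 ≤ y) :
    u x t - u y t ≤ 2 * (C + F + 1) * (2 * (x - y) - (x - y) ^ 2) + ε * x ^ 2 := by
  have hC := H.C_nonneg
  have hF := H.F_nonneg
  have hlin : ∀ y s, y ≤ h s → -u y s ≤ 2 * (C + F + 1) * (h s - y) := fun y s => H.neg.le_linear
  set B := 2 * (C + F + 1) with hB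
  obtain ⟨R, hR0, hRx, hR⟩ : ∃ R : ℝ, 0 < R ∧ -R ≤ x ∧ 2 * C ≤ ε * R ^ 2 := by
    have hq : 0 ≤ 2 * C / ε := by positivity
    refine ⟨|x| + 2 * C / ε + 1, by positivity, by linarith [neg_abs_le x], ?_⟩
    have h1 : 2 * C / ε ≤ (|x| + 2 * C / ε + 1) ^ 2 := by nlinarith [abs_nonneg x]
    calc 2 * C = ε * (2 * C / ε) := by field_simp
      _ ≤ _ := by gcongr
  have hc := H.diff.continuous
  have hS : IsCompact {p : ℝ × ℝ × ℝ | (t - 2 * C ≤ p.2.2 ∧ p.2.2 ≤ t) ∧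
      (-R ≤ p.1 ∧ p.1 ≤ h p.2.2) ∧ p.1 - 1 ≤ p.2.1 ∧ p.2.1 ≤ p.1} := by
    refine IsCompact.of_isClosed_subset ((isCompact_Icc (a := -R) (b := h t)).prod
      ((isCompact_Icc (a := -R - 1) (b := h t)).prod
        (isCompact_Icc (a := t - 2 * C) (b := t)))) ?_ ?_
    · simp only [ofPred_and]
      refine .inter (.inter ?_ ?_) (.inter (.inter ?_ ?_) (.inter ?_ ?_)) <;>
        exact isClosed_le (by fun_prop) (by fun_prop)
    · rintro ⟨x, y, s⟩ ⟨⟨h1, h2⟩, ⟨h3, h4⟩, h5, h6⟩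
      have := H.mono h2
      simp only [mem_prod, mem_Icc] at *
      exact ⟨⟨by linarith, by linarith⟩, ⟨by linarith, by linarith⟩, h1, h2⟩
  have key := nonpos_of_no_positive_max hS
    (Φ := fun p => u p.1 p.2.2 - u p.2.1 p.2.2 - B * (2 * (p.1 - p.2.1) - (p.1 - p.2.1) ^ 2)
      - ε * p.1 ^ 2 + (p.2.2 - t)) ?_ ?_
    (x, y, t) ⟨⟨by simp; linarith, le_rfl⟩, ⟨hRx, hx⟩, hxy, hy⟩
  · simp only [sub_self, add_zero] at key
    linarith
  · refine ((((H.continuousOn_comp ?_ ?_ ?_).sub (H.continuousOn_comp ?_ ?_ ?_)).sub ?_).sub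
      ?_).add ?_
    all_goals first
      | fun_prop
      | exact fun p hp => hp.2.1.2
      | exact fun p hp => hp.2.2.2.trans hp.2.1.2
  rintro ⟨x, y, s⟩ ⟨⟨h1, h2⟩, ⟨h3, h4⟩, h5, h6⟩ hmax hpos
  simp only at h1 h2 h3 h4 h5 h6 hpos
  have hux := abs_le.1 (H.bdd x s)
  have huy := abs_le.1 (H.bdd y s)
  have hW : B * (x - y) ≤ B * (2 * (x - y) - (x - y) ^ 2) :=
    mul_le_mul_of_nonneg_left (by nlinarith) (by linarith)
  have hW0 : 0 ≤ B * (x - y) := mul_nonneg (by linarith) (by linarith)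
  have hεx : 0 ≤ ε * x ^ 2 := by positivity
  have h1' : t - 2 * C < s := lt_of_le_of_ne h1 fun he => by linarith
  have h3' : -R < x := lt_of_le_of_ne h3 fun he => by
    rw [← neg_sq, he] at hR
    linarith
  have h4' : x < h s := lt_of_le_of_ne h4 fun he => by
    rw [he, H.bdry s] at hpos
    rw [he] at hW hεx
    linarith [hlin y s (by linarith)]
  have h5' : x - 1 < y := lt_of_le_of_ne h5 fun he => by
    rw [show x - y = 1 by linarith] at *
    linarith
  have h6' : y < x := lt_of_le_of_ne h6 fun he => by
    simp [he] at hpos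
    linarith
  have h7' : y < h s := h6'.trans h4'
  have ht := deriv_nonneg_of_past_max (t := s) (((((H.reg_t s x h4').hasDerivAt.sub
    (H.reg_t s y h7').hasDerivAt).sub_const (B * (2 * (x - y) - (x - y) ^ 2))).sub_const
      (ε * x ^ 2)).add ((hasDerivAt_id s).sub_const t)) (by
    filter_upwards [self_mem_nhdsWithin, (eventually_gt_nhds h1').filter_mono nhdsWithin_le_nhds,
      (hc.continuousAt.eventually_const_lt h4').filter_mono nhdsWithin_le_nhds] with r h8 h9 h10
    exact hmax (x, y, r) ⟨⟨h9.le, (mem_Iio.1 h8).le.trans h2⟩, ⟨h3, h10.le⟩, h5, h6⟩)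
  have hxx := second_deriv_nonpos_of_isLocalMax (x := x)
    (c := deriv (deriv fun z => u z s) x + 2 * B - 2 * ε)
    (f := fun z => u z s - u y s - B * (2 * (z - y) - (z - y) ^ 2) - ε * z ^ 2 + (s - t))
    (f' := fun z => deriv (fun z => u z s) z - B * (2 - 2 * (z - y)) - 2 * ε * z) ?_ ?_ ?_
  rotate_left
  · filter_upwards [H.eventually_hasDerivAt h4'] with z hz
    have h8 := (hasDerivAt_id' z).sub_const y
    exact ((((hz.sub_const (u y s)).sub (((h8.const_mul 2).sub (h8.pow 2)).const_mul B)).sub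
      (((hasDerivAt_id' z).pow 2).const_mul ε)).add_const (s - t)).congr_deriv (by simp; ring)
  · have h8 := (hasDerivAt_id' x).sub_const y
    exact (((H.reg_xx s x h4').hasDerivAt.sub
      (((h8.const_mul 2).const_sub 2).const_mul B)).sub
        ((hasDerivAt_id' x).const_mul (2 * ε))).congr_deriv (by ring)
  · filter_upwards [eventually_gt_nhds h3', eventually_lt_nhds h4', eventually_gt_nhds h6',
      eventually_lt_nhds (show x < y + 1 by linarith)] with z h8 h9 h10 h11
    exact hmax (z, y, s) ⟨⟨h1, h2⟩, ⟨h8.le, h9.le⟩, by simp only; linarith, h10.le⟩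
  have hyy := second_deriv_nonpos_of_isLocalMax (x := y)
    (c := -deriv (deriv fun z => u z s) y + 2 * B)
    (f := fun z => u x s - u z s - B * (2 * (x - z) - (x - z) ^ 2) - ε * x ^ 2 + (s - t))
    (f' := fun z => -deriv (fun z => u z s) z + B * (2 - 2 * (x - z))) ?_ ?_ ?_
  rotate_left
  · filter_upwards [H.eventually_hasDerivAt h7'] with z hz
    have h8 := (hasDerivAt_id' z).const_sub x
    exact ((((hz.const_sub (u x s)).sub (((h8.const_mul 2).sub (h8.pow 2)).const_mul B)).sub_const
      (ε * x ^ 2)).add_const (s - t)).congr_deriv (by simp; ring)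
  · have h8 := (hasDerivAt_id' y).const_sub x
    exact ((H.reg_xx s y h7').hasDerivAt.neg.add
      (((h8.const_mul 2).const_sub 2).const_mul B)).congr_deriv (by ring)
  · filter_upwards [eventually_gt_nhds h5', eventually_lt_nhds h6'] with z h8 h9
    exact hmax (x, z, s) ⟨⟨h1, h2⟩, ⟨h3, h4⟩, h8.le, h9.le⟩
  have hpx := abs_le.1 (H.pde s x h4')
  have hpy := abs_le.1 (H.pde s y h7')
  linarith

/-- Lipschitz bound in space, for nearby points. -/
lemma abs_sub_le (H : HeatFront u h C F) {x y t : ℝ} (hx : x ≤ h t) (hy : y ≤ x)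
    (hxy : x - 1 ≤ y) : |u x t - u y t| ≤ 4 * (C + F + 1) * (x - y) := by
  have main : ∀ {w : ℝ → ℝ → ℝ}, HeatFront w h C F →
      w x t - w y t ≤ 4 * (C + F + 1) * (x - y) := by
    intro w Hw
    have hC := H.C_nonneg
    have hF := H.F_nonneg
    have hlim : Tendsto (fun ε : ℝ => 2 * (C + F + 1) * (2 * (x - y) - (x - y) ^ 2) + ε * x ^ 2)
        (𝓝[>] 0) (𝓝 (2 * (C + F + 1) * (2 * (x - y) - (x - y) ^ 2) + 0 * x ^ 2)) :=
      (Continuous.tendsto (by fun_prop) 0).mono_left nhdsWithin_le_nhds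
    have := ge_of_tendsto hlim (by
      filter_upwards [Ioc_mem_nhdsGT (zero_lt_one (α := ℝ))] with ε hε
      exact Hw.sub_le_aux hε.1 hε.2 hx hy hxy)
    nlinarith [sq_nonneg (x - y)]
  have h1 := main H
  have h2 := main H.neg
  exact abs_le.2 ⟨by linarith, h1⟩

/-- One-sided form of approximate additivity near the front. -/
lemma add_sub_le (H : HeatFront u h C F) {K : ℝ} (hK : ∀ t, deriv h t ≤ K) {a b t : ℝ}
    (ha : a ∈ Icc (0 : ℝ) 1) (hb : b ∈ Icc (0 : ℝ) 1) :
    u (h t - a) t + u (h t - b) t - u (h t - a - b) t ≤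
      (6 * (C + F + 1) + 4 * (C + F + 1) * K) * (a * b) := by
  have hC := H.C_nonneg
  have hF := H.F_nonneg
  have hlin : ∀ y s, y ≤ h s → u y s ≤ 2 * (C + F + 1) * (h s - y) := fun y s => H.le_linear
  have hlip : ∀ x y s, x ≤ h s → y ≤ x → x - 1 ≤ y →
    |u x s - u y s| ≤ 4 * (C + F + 1) * (x - y) := fun x y s => H.abs_sub_le
  have hK0 : 0 ≤ K := (H.deriv_front_nonneg 0).trans (hK 0)
  set A := C + F + 1 with hA
  have hA0 : 0 < A := by linarith
  set Q := 6 * A + 4 * A * K with hQ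
  have hQA : 6 * A ≤ Q := by nlinarith
  have hc := H.diff.continuous
  have hS : IsCompact {p : ℝ × ℝ × ℝ | (t - 3 * C ≤ p.2.2 ∧ p.2.2 ≤ t) ∧
      (h p.2.2 - 1 ≤ p.1 ∧ p.1 ≤ h p.2.2) ∧ h p.2.2 - 1 ≤ p.2.1 ∧ p.2.1 ≤ h p.2.2} := by
    refine IsCompact.of_isClosed_subset
      ((isCompact_Icc (a := h (t - 3 * C) - 1) (b := h t)).prod
      ((isCompact_Icc (a := h (t - 3 * C) - 1) (b := h t)).prod
        (isCompact_Icc (a := t - 3 * C) (b := t)))) ?_ ?_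
    · simp only [ofPred_and]
      refine .inter (.inter ?_ ?_) (.inter (.inter ?_ ?_) (.inter ?_ ?_)) <;>
        exact isClosed_le (by fun_prop) (by fun_prop)
    · rintro ⟨x, y, s⟩ ⟨⟨h1, h2⟩, ⟨h3, h4⟩, h5, h6⟩
      have := H.mono h1
      have := H.mono h2
      simp only [mem_prod, mem_Icc] at *
      exact ⟨⟨by linarith, by linarith⟩, ⟨by linarith, by linarith⟩, h1, h2⟩
  have key := nonpos_of_no_positive_max hS
    (Φ := fun p => u p.1 p.2.2 + u p.2.1 p.2.2 - u (p.1 + p.2.1 - h p.2.2) p.2.2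
      - Q * ((h p.2.2 - p.1) * (h p.2.2 - p.2.1)) + (p.2.2 - t)) ?_ ?_
    (h t - a, h t - b, t) ⟨⟨by simp; linarith, le_rfl⟩, ⟨by simp; linarith [ha.2],
      by simp; linarith [ha.1]⟩, by simp; linarith [hb.2], by simp; linarith [hb.1]⟩
  · simp only [sub_self, add_zero, sub_sub_cancel] at key
    rw [show h t - a + (h t - b) - h t = h t - a - b by ring] at key
    linarith
  · refine ((((H.continuousOn_comp ?_ ?_ ?_).add (H.continuousOn_comp ?_ ?_ ?_)).sub
      (H.continuousOn_comp ?_ ?_ ?_)).sub ?_).add ?_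
    all_goals first
      | fun_prop
      | exact fun p hp => hp.2.1.2
      | exact fun p hp => hp.2.2.2
      | exact fun p hp => by linarith [hp.2.1.2, hp.2.2.2]
  rintro ⟨x, y, s⟩ ⟨⟨h1, h2⟩, ⟨h3, h4⟩, h5, h6⟩ hmax hpos
  simp only at h1 h2 h3 h4 h5 h6 hpos
  have hux := abs_le.1 (H.bdd x s)
  have huy := abs_le.1 (H.bdd y s)
  have huz := abs_le.1 (H.bdd (x + y - h s) s)
  have hQ0 : 0 ≤ Q * ((h s - x) * (h s - y)) :=
    mul_nonneg (by linarith) (mul_nonneg (by linarith) (by linarith))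
  have hQx : 6 * A * (h s - x) ≤ Q * (h s - x) :=
    mul_le_mul_of_nonneg_right hQA (by linarith)
  have hQy : 6 * A * (h s - y) ≤ Q * (h s - y) :=
    mul_le_mul_of_nonneg_right hQA (by linarith)
  have h1' : t - 3 * C < s := lt_of_le_of_ne h1 fun he => by linarith
  have h3' : h s - 1 < x := lt_of_le_of_ne h3 fun he => by
    rw [show h s - x = 1 by linarith] at hpos
    have h8 := (abs_le.1 (hlip x (x + y - h s) s h4 (by linarith) (by linarith))).2
    have h9 := hlin y s h6
    linarith
  have h5' : h s - 1 < y := lt_of_le_of_ne h5 fun he => by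
    rw [show h s - y = 1 by linarith] at hpos
    have h8 := (abs_le.1 (hlip y (x + y - h s) s h6 (by linarith) (by linarith))).2
    have h9 := hlin x s h4
    linarith
  have h4' : x < h s := lt_of_le_of_ne h4 fun he => by
    rw [he, H.bdry s] at hpos
    simp at hpos
    linarith
  have h6' : y < h s := lt_of_le_of_ne h6 fun he => by
    rw [he, H.bdry s] at hpos
    simp at hpos
    linarith
  obtain ⟨z, hz⟩ : ∃ z, z = x + y - h s := ⟨_, rfl⟩
  have hzs : z < h s := by linarith
  have hh := (H.diff s).hasDerivAt
  have ht := deriv_nonneg_of_past_max (t := s) ((((((H.reg_t s x h4').hasDerivAt.add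
    (H.reg_t s y h6').hasDerivAt).sub (H.reg_t s z hzs).hasDerivAt).sub
      (((hh.sub_const x).mul (hh.sub_const y)).const_mul Q)).add
        ((hasDerivAt_id s).sub_const t)).add (hh.const_mul (4 * A))) (by
    filter_upwards [self_mem_nhdsWithin, H.eventually_strip h1' h2 h3' h4',
      H.eventually_strip h1' h2 h5' h6', (hc.continuousAt.eventually_const_lt
        (show h s - 1 < h s by linarith)).filter_mono nhdsWithin_le_nhds] with r h8 h9 h10 h11
    have h12 := hmax (x, y, r) ⟨h9.1, h9.2, h10.2⟩
    have h13 := H.mono (mem_Iio.1 h8).le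
    have h14 := (abs_le.1 (hlip (x + y - h r) z r (by linarith [h9.2.2, h10.2.2])
      (by linarith) (by linarith))).2
    rw [show x + y - h r - z = h s - h r by rw [hz]; ring] at h14
    simp only [← hz] at h12
    simp
    linarith)
  have hxx := second_deriv_nonpos_of_isLocalMax (x := x)
    (c := deriv (deriv fun z => u z s) x - deriv (deriv fun z => u z s) z)
    (f := fun w => u w s + u y s - u (w + y - h s) s - Q * ((h s - w) * (h s - y)) + (s - t))
    (f' := fun w => deriv (fun z => u z s) w - deriv (fun z => u z s) (w + y - h s)
      + Q * (h s - y)) ?_ ?_ ?_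
  rotate_left
  · have hcont : Tendsto (fun w => w + y - h s) (𝓝 x) (𝓝 z) := by
      rw [hz]; exact Continuous.tendsto (by fun_prop) x
    filter_upwards [H.eventually_hasDerivAt h4', hcont.eventually (H.eventually_hasDerivAt hzs)]
      with w hw hw'
    have h8 : HasDerivAt (fun w => w + y - h s) 1 w :=
      ((hasDerivAt_id' w).add_const y).sub_const (h s)
    exact ((((hw.add_const (u y s)).sub (hw'.comp w h8)).sub
      ((((hasDerivAt_id' w).const_sub (h s)).mul_const (h s - y)).const_mul Q)).add_const
        (s - t)).congr_deriv (by ring)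
  · have h8 : HasDerivAt (fun w => w + y - h s) 1 x :=
      ((hasDerivAt_id' x).add_const y).sub_const (h s)
    have h9 := (H.reg_xx s z hzs).hasDerivAt
    rw [hz] at h9
    rw [hz]
    exact (((H.reg_xx s x h4').hasDerivAt.sub (h9.comp x h8)).add_const
      (Q * (h s - y))).congr_deriv (by ring)
  · filter_upwards [eventually_gt_nhds h3', eventually_lt_nhds h4'] with w h8 h9
    exact hmax (w, y, s) ⟨⟨h1, h2⟩, ⟨h8.le, h9.le⟩, h5, h6⟩
  have hyy := second_deriv_nonpos_of_isLocalMax (x := y)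
    (c := deriv (deriv fun z => u z s) y - deriv (deriv fun z => u z s) z)
    (f := fun w => u x s + u w s - u (x + w - h s) s - Q * ((h s - x) * (h s - w)) + (s - t))
    (f' := fun w => deriv (fun z => u z s) w - deriv (fun z => u z s) (x + w - h s)
      + Q * (h s - x)) ?_ ?_ ?_
  rotate_left
  · have hcont : Tendsto (fun w => x + w - h s) (𝓝 y) (𝓝 z) := by
      rw [hz]; exact Continuous.tendsto (by fun_prop) y
    filter_upwards [H.eventually_hasDerivAt h6', hcont.eventually (H.eventually_hasDerivAt hzs)]
      with w hw hw'
    have h8 : HasDerivAt (fun w => x + w - h s) 1 w :=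
      ((hasDerivAt_id' w).const_add x).sub_const (h s)
    exact ((((hw.const_add (u x s)).sub (hw'.comp w h8)).sub
      ((((hasDerivAt_id' w).const_sub (h s)).const_mul (h s - x)).const_mul Q)).add_const
        (s - t)).congr_deriv (by ring)
  · have h8 : HasDerivAt (fun w => x + w - h s) 1 y :=
      ((hasDerivAt_id' y).const_add x).sub_const (h s)
    have h9 := (H.reg_xx s z hzs).hasDerivAt
    rw [hz] at h9
    rw [hz]
    exact (((H.reg_xx s y h6').hasDerivAt.sub (h9.comp y h8)).add_const
      (Q * (h s - x))).congr_deriv (by ring)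
  · filter_upwards [eventually_gt_nhds h5', eventually_lt_nhds h6'] with w h8 h9
    exact hmax (x, w, s) ⟨⟨h1, h2⟩, ⟨h3, h4⟩, h8.le, h9.le⟩
  have hxy := second_deriv_nonpos_of_isLocalMax (x := x)
    (c := deriv (deriv fun z => u z s) x + deriv (deriv fun z => u z s) y + 2 * Q)
    (f := fun w => u w s + u (x + y - w) s - u z s - Q * ((h s - w) * (h s - (x + y - w)))
      + (s - t))
    (f' := fun w => deriv (fun z => u z s) w - deriv (fun z => u z s) (x + y - w)
      + Q * (2 * w - x - y)) ?_ ?_ ?_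
  rotate_left
  · have hcont : Tendsto (fun w => x + y - w) (𝓝 x) (𝓝 y) := by
      convert Continuous.tendsto (f := fun w => x + y - w) (by fun_prop) x using 2
      ring
    filter_upwards [H.eventually_hasDerivAt h4', hcont.eventually (H.eventually_hasDerivAt h6')]
      with w hw hw'
    have h8 : HasDerivAt (fun w => x + y - w) (-1) w := (hasDerivAt_id' w).const_sub (x + y)
    exact ((((hw.add (hw'.comp w h8)).sub_const (u z s)).sub
      ((((hasDerivAt_id' w).const_sub (h s)).mul (h8.const_sub (h s))).const_mul Q)).add_const
        (s - t)).congr_deriv (by ring)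
  · have h8 : HasDerivAt (fun w => x + y - w) (-1) x := (hasDerivAt_id' x).const_sub (x + y)
    have h9 := (H.reg_xx s y h6').hasDerivAt
    rw [show y = x + y - x by ring] at h9
    refine (((H.reg_xx s x h4').hasDerivAt.sub (h9.comp x h8)).add
      (((((hasDerivAt_id' x).const_mul 2).sub_const x).sub_const y).const_mul
        Q)).congr_deriv ?_
    rw [show x + y - x = y by ring]
    ring
  · filter_upwards [eventually_gt_nhds h3', eventually_lt_nhds h4',
      eventually_gt_nhds (show x + y - h s < x by linarith),
      eventually_lt_nhds (show x < x + y - (h s - 1) by linarith)] with w h8 h9 h10 h11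
    have h12 := hmax (w, x + y - w, s) ⟨⟨h1, h2⟩, ⟨h8.le, h9.le⟩, by simp only; linarith,
      by simp only; linarith⟩
    simp only [add_sub_cancel, ← hz] at h12
    rwa [add_sub_cancel_left]
  have hpx := abs_le.1 (H.pde s x h4')
  have hpy := abs_le.1 (H.pde s y h6')
  have hpz := abs_le.1 (H.pde s z hzs)
  have hd := H.deriv_front_nonneg s
  have h20 : 4 * A * deriv h s ≤ 4 * A * K := mul_le_mul_of_nonneg_left (hK s) (by linarith)
  have h21 : 0 ≤ Q * (deriv h s * (h s - y) + (h s - x) * deriv h s) :=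
    mul_nonneg (by linarith) (add_nonneg (mul_nonneg hd (by linarith))
      (mul_nonneg (by linarith) hd))
  linarith

/-- Approximate additivity near the front. -/
lemma abs_add_sub_le (H : HeatFront u h C F) {K : ℝ} (hK : ∀ t, deriv h t ≤ K) {a b t : ℝ}
    (ha : a ∈ Icc (0 : ℝ) 1) (hb : b ∈ Icc (0 : ℝ) 1) :
    |u (h t - a) t + u (h t - b) t - u (h t - a - b) t| ≤
      (6 * (C + F + 1) + 4 * (C + F + 1) * K) * (a * b) := by
  have h1 := H.add_sub_le hK ha hb (t := t)
  have h2 := H.neg.add_sub_le hK ha hb (t := t)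
  exact abs_le.2 ⟨by linarith, h1⟩

/-- Uniform differentiability at the front. -/
lemma abs_add_mul_deriv_le (H : HeatFront u h C F) {K : ℝ} (hK : ∀ t, deriv h t ≤ K) {a t : ℝ}
    (ha : a ∈ Icc (0 : ℝ) 1) (hd : DifferentiableAt ℝ (fun y => u y t) (h t)) :
    |u (h t - a) t + deriv (fun y => u y t) (h t) * a| ≤
      (6 * (C + F + 1) + 4 * (C + F + 1) * K) * a * a := by
  set Q := 6 * (C + F + 1) + 4 * (C + F + 1) * K
  set D := deriv (fun y => u y t) (h t)
  have hD0 : HasDerivAt (fun y => u (h t - y) t) (-D) 0 := by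
    have := hd.hasDerivAt
    rw [show h t = h t - 0 by ring] at this
    exact (this.comp 0 ((hasDerivAt_id' 0).const_sub (h t))).congr_deriv (by simp [D])
  have hDb : ∀ b : ℝ, 0 < b → HasDerivAt (fun y => u (h t - y) t)
      (-deriv (fun y => u y t) (h t - b)) b := fun b hb =>
    ((H.reg_x t (h t - b) (by linarith)).hasDerivAt.comp b
      ((hasDerivAt_id' b).const_sub (h t))).congr_deriv (by simp)
  have hslope : ∀ b : ℝ, 0 < b → b ≤ 1 → |-deriv (fun y => u y t) (h t - b) + D| ≤ Q * b := by
    intro b hb hb1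
    have e0 := hD0.tendsto_slope_zero_right
    have e1 := (hDb b hb).tendsto_slope_zero_right
    have e2 := (e1.sub e0).abs
    rw [sub_neg_eq_add] at e2
    refine le_of_tendsto e2 ?_
    filter_upwards [Ioc_mem_nhdsGT (zero_lt_one (α := ℝ))] with r hr
    have h3 := H.abs_add_sub_le hK (t := t) ⟨hb.le, hb1⟩ ⟨hr.1.le, hr.2⟩
    simp only [zero_add, sub_zero, H.bdry, smul_eq_mul]
    rw [← mul_sub, abs_mul, abs_of_pos (inv_pos.2 hr.1), inv_mul_le_iff₀ hr.1, ← abs_neg,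
      show h t - (b + r) = h t - b - r by ring]
    calc _ = |u (h t - b) t + u (h t - r) t - u (h t - b - r) t| := by congr 1; ring
      _ ≤ _ := h3.trans_eq (by ring)
  have hE : ∀ b ∈ Icc 0 a, HasDerivWithinAt (fun y => u (h t - y) t + D * y)
      ((if b = 0 then -D else -deriv (fun y => u y t) (h t - b)) + D) (Icc 0 a) b := by
    intro b hb
    have hl : HasDerivAt (fun y => D * y) D b := by simpa using (hasDerivAt_id' b).const_mul D
    split_ifs with h0
    · rw [h0] at hl ⊢
      exact (hD0.add hl).hasDerivWithinAt
    · exact ((hDb b (lt_of_le_of_ne hb.1 (Ne.symm h0))).add hl).hasDerivWithinAt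
  have hQ : 0 ≤ Q := by
    simpa using (abs_nonneg _).trans (H.abs_add_sub_le hK (t := t) (a := 1) (b := 1)
      ⟨zero_le_one, le_rfl⟩ ⟨zero_le_one, le_rfl⟩)
  have := (convex_Icc 0 a).norm_image_sub_le_of_norm_hasDerivWithin_le (C := Q * a) hE
    (fun b hb => by
      split_ifs with h0
      · simpa using mul_nonneg hQ ha.1
      · exact (hslope b (lt_of_le_of_ne hb.1 (Ne.symm h0)) (hb.2.trans ha.2)).trans
          (mul_le_mul_of_nonneg_left hb.2 hQ)) ⟨le_rfl, ha.1⟩ ⟨ha.1, le_rfl⟩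
  simpa [H.bdry, abs_of_nonneg ha.1] using this

end HeatFront
namespace BohrAlmostPeriodic

lemma abs_bounded {p : ℝ → ℝ} (hp : BohrAlmostPeriodic p) (hc : Continuous p) :
    ∃ P : ℝ, ∀ x, |p x| ≤ P := by
  obtain ⟨L, hL, hs⟩ := hp 1 one_pos
  obtain ⟨P, hP⟩ := (isCompact_Icc (a := 0) (b := L)).exists_bound_of_continuousOn hc.continuousOn
  refine ⟨P + 1, fun x => ?_⟩
  obtain ⟨s, ⟨h1, h2⟩, h3⟩ := hs (-x)
  have h4 := hP (x + s) ⟨by linarith, by linarith⟩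
  rw [Real.norm_eq_abs] at h4
  linarith [abs_sub_abs_le_abs_sub (p x) (p (x + s)), h3 x, abs_sub_comm (p x) (p (x + s))]

lemma inv {p : ℝ → ℝ} (hp : BohrAlmostPeriodic p) {m : ℝ} (hm : 0 < m) (hpm : ∀ x, m ≤ p x) :
    BohrAlmostPeriodic fun x => (p x)⁻¹ := by
  intro ε hε
  obtain ⟨L, hL, hs⟩ := hp (ε * (m * m)) (by positivity)
  refine ⟨L, hL, fun t => ?_⟩
  obtain ⟨s, hst, h1⟩ := hs t
  refine ⟨s, hst, fun x => ?_⟩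
  have hx := hm.trans_le (hpm x)
  have hxs := hm.trans_le (hpm (x + s))
  rw [inv_sub_inv hxs.ne' hx.ne', abs_div, abs_of_pos (mul_pos hxs hx), div_lt_iff₀ (by positivity),
    abs_sub_comm]
  refine (h1 x).trans_le (mul_le_mul_of_nonneg_left ?_ hε.le)
  exact mul_le_mul (hpm _) (hpm _) hm.le hxs.le

lemma abs_integral_sub_le {p : ℝ → ℝ} (hp : BohrAlmostPeriodic p) (hc : Continuous p) {P : ℝ}
    (hP : ∀ x, |p x| ≤ P) {ε : ℝ} (hε : 0 < ε) :
    ∃ B : ℝ, 0 ≤ B ∧ ∀ T ≥ 0, ∀ r,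
      |(∫ x in r..(r + T), p x) - ∫ x in (0 : ℝ)..T, p x| ≤ ε * T + B := by
  have hP0 : 0 ≤ P := (abs_nonneg _).trans (hP 0)
  have hi : ∀ a b, IntervalIntegrable p MeasureTheory.volume a b := hc.intervalIntegrable
  obtain ⟨L, hL, hs⟩ := hp ε hε
  refine ⟨2 * (P * L), by positivity, fun T hT r => ?_⟩
  obtain ⟨s, ⟨h1, h2⟩, h3⟩ := hs r
  have hb : ∀ a, |∫ x in a..(a + (s - r)), p x| ≤ P * L := fun a => by
    refine (intervalIntegral.norm_integral_le_of_norm_le_const (f := p) (C := P)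
      fun x _ => hP x).trans ?_
    rw [add_sub_cancel_left, abs_of_nonneg (by linarith)]
    exact mul_le_mul_of_nonneg_left (by linarith) hP0
  have e1 : (∫ x in (0 : ℝ)..T, p (x + s)) = ∫ x in s..(s + T), p x := by
    rw [intervalIntegral.integral_comp_add_right, zero_add, add_comm T s]
  have e2 : |(∫ x in s..(s + T), p x) - ∫ x in (0 : ℝ)..T, p x| ≤ ε * T := by
    rw [← e1, ← intervalIntegral.integral_sub (Continuous.intervalIntegrable (by fun_prop) _ _)
      (hi _ _)]
    refine (intervalIntegral.norm_integral_le_of_norm_le_const (f := fun x => p (x + s) - p x) (C := ε)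
      fun x _ => (h3 x).le).trans ?_
    rw [sub_zero, abs_of_nonneg hT]
  have e3 := intervalIntegral.integral_add_adjacent_intervals (hi r s) (hi s (s + T))
  have e4 := intervalIntegral.integral_add_adjacent_intervals (hi r (r + T)) (hi (r + T) (s + T))
  have b1 := abs_le.1 (hb r)
  have b2 := abs_le.1 (hb (r + T))
  rw [show r + (s - r) = s by ring] at b1
  rw [show r + T + (s - r) = s + T by ring] at b2
  have b3 := abs_le.1 e2
  exact abs_le.2 ⟨by linarith, by linarith⟩

lemma abs_integral_nsmul_sub_le {p : ℝ → ℝ} (hc : Continuous p) {T B : ℝ}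
    (hB : ∀ r, |(∫ x in r..(r + T), p x) - ∫ x in (0 : ℝ)..T, p x| ≤ B) (n : ℕ) :
    |(∫ x in (0 : ℝ)..(n * T), p x) - n * ∫ x in (0 : ℝ)..T, p x| ≤ n * B := by
  have hi : ∀ a b, IntervalIntegrable p MeasureTheory.volume a b := hc.intervalIntegrable
  induction n with
  | zero => simp
  | succ n ih =>
    have e := intervalIntegral.integral_add_adjacent_intervals (hi 0 (n * T))
      (hi (n * T) (n * T + T))
    have h1 := abs_le.1 (hB (n * T))
    have h2 := abs_le.1 ih
    push_cast
    rw [show ((n : ℝ) + 1) * T = n * T + T by ring, ← e]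
    exact abs_le.2 ⟨by linarith, by linarith⟩

/-- A continuous almost periodic function has a mean value, uniformly over intervals. -/
lemma exists_mean {p : ℝ → ℝ} (hp : BohrAlmostPeriodic p) (hc : Continuous p) :
    ∃ A : ℝ, ∀ ε > (0 : ℝ), ∃ D > (0 : ℝ), ∀ r s : ℝ, D ≤ s - r →
      |(∫ x in r..s, p x) / (s - r) - A| ≤ ε := by
  obtain ⟨P, hP⟩ := hp.abs_bounded hc
  have hP0 : 0 ≤ P := (abs_nonneg _).trans (hP 0)
  have hi : ∀ a b, IntervalIntegrable p MeasureTheory.volume a b := hc.intervalIntegrable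
  have hbd : ∀ a b, |∫ x in a..b, p x| ≤ P * |b - a| := fun a b =>
    intervalIntegral.norm_integral_le_of_norm_le_const (f := p) (C := P) fun x _ => hP x
  set I : ℝ → ℝ := fun T => ∫ x in (0 : ℝ)..T, p x with hI
  have hcmp : ∀ ε > (0 : ℝ), ∃ T > (0 : ℝ), ∃ N > (0 : ℝ), ∀ S ≥ N,
      |I S / S - I T / T| ≤ ε := by
    intro ε hε
    obtain ⟨B, hB0, hB⟩ := hp.abs_integral_sub_le hc hP (show 0 < ε / 3 by positivity)
    set T := 3 * B / ε + 1 with hT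
    have hT0 : 0 < T := by positivity
    have hBT : B ≤ ε / 3 * T := by rw [hT]; field_simp; linarith
    refine ⟨T, hT0, 6 * P * T / ε + 1, by positivity, fun S hS => ?_⟩
    have hS0 : 0 < S := lt_of_lt_of_le (by positivity) hS
    have hPT : 2 * (P * T) ≤ ε / 3 * S := by
      have : 6 * P * T / ε ≤ S := by linarith
      rw [div_le_iff₀ hε] at this
      linarith
    obtain ⟨n, hn⟩ : ∃ n : ℕ, n = ⌊S / T⌋₊ := ⟨_, rfl⟩
    have hn1 : (n : ℝ) ≤ S / T := by rw [hn]; exact Nat.floor_le (by positivity)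
    have hn2 : S / T < n + 1 := by rw [hn]; exact Nat.lt_floor_add_one _
    have hn1' : n * T ≤ S := (le_div_iff₀ hT0).1 hn1
    have hn2' : S < (n + 1) * T := (div_lt_iff₀ hT0).1 hn2
    have h1 := abs_le.1 (abs_integral_nsmul_sub_le hc (hB T hT0.le) n)
    have h2 := hbd (n * T) S
    rw [abs_of_nonneg (by linarith : 0 ≤ S - n * T)] at h2
    have h2' := abs_le.1 (h2.trans (mul_le_mul_of_nonneg_left (by linarith : S - n * T ≤ T) hP0))
    have h3 := intervalIntegral.integral_add_adjacent_intervals (hi 0 (n * T)) (hi (n * T) S)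
    have h4 : |(n - S / T) * I T| ≤ P * T := by
      have := hbd 0 T
      rw [sub_zero, abs_of_pos hT0] at this
      rw [abs_mul]
      calc _ ≤ 1 * |I T| := by
            gcongr
            exact abs_le.2 ⟨by linarith, by linarith⟩
        _ ≤ _ := by rwa [one_mul]
    have h4' := abs_le.1 h4
    have h5 : (n : ℝ) * (ε / 3 * T + B) ≤ 2 * (ε / 3) * S := by
      calc (n : ℝ) * (ε / 3 * T + B) ≤ n * (2 * (ε / 3) * T) := by gcongr; linarith
        _ = 2 * (ε / 3) * (n * T) := by ring
        _ ≤ _ := by gcongr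
    have h6 : |I S - S / T * I T| ≤ ε * S := by
      simp only [← hI] at *
      refine abs_le.2 ⟨?_, ?_⟩ <;> linarith
    rw [show I S / S - I T / T = (I S - S / T * I T) / S by field_simp, abs_div, abs_of_pos hS0,
      div_le_iff₀ hS0]
    exact h6
  have hcau : CauchySeq fun T => I T / T := by
    refine Metric.cauchySeq_iff.2 fun ε hε => ?_
    obtain ⟨T, -, N, -, hN⟩ := hcmp (ε / 3) (by positivity)
    refine ⟨N, fun a ha b hb => ?_⟩
    rw [Real.dist_eq]
    have h1 := abs_le.1 (hN a ha)
    have h2 := abs_le.1 (hN b hb)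
    exact abs_lt.2 ⟨by linarith, by linarith⟩
  obtain ⟨A, hA⟩ := cauchySeq_tendsto_of_complete hcau
  refine ⟨A, fun ε hε => ?_⟩
  obtain ⟨B, hB0, hB⟩ := hp.abs_integral_sub_le hc hP (show 0 < ε / 3 by positivity)
  obtain ⟨N, hN⟩ := (Metric.tendsto_atTop.1 hA) (ε / 3) (by positivity)
  refine ⟨max N (3 * B / ε + 1), lt_max_of_lt_right (by positivity), fun r s hrs => ?_⟩
  have hT0 : 0 < s - r := lt_of_lt_of_le (lt_max_of_lt_right (by positivity)) hrs
  have h1 := hN (s - r) ((le_max_left _ _).trans hrs)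
  have h2 := hB (s - r) hT0.le r
  have h3 : B ≤ ε / 3 * (s - r) := by
    have : 3 * B / ε ≤ s - r := by linarith [(le_max_right _ _).trans hrs]
    rw [div_le_iff₀ hε] at this
    linarith
  rw [add_sub_cancel] at h2
  have h4 : |(∫ x in r..s, p x) / (s - r) - I (s - r) / (s - r)| ≤ 2 * (ε / 3) := by
    rw [← sub_div, abs_div, abs_of_pos hT0, div_le_iff₀ hT0]
    exact h2.trans (by linarith)
  rw [Real.dist_eq] at h1
  have h5 := abs_le.1 h4
  have h6 := abs_lt.1 h1
  exact abs_le.2 ⟨by linarith, by linarith⟩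

end BohrAlmostPeriodic

lemma IsBddPosSteadyState.continuous_coeff {g w : ℝ → ℝ} (hw : IsBddPosSteadyState g w) :
    Continuous g := by
  obtain ⟨h1, -, h3, h4⟩ := hw
  have h5 : g = fun x => w x - deriv (deriv w) x / w x := by
    funext x
    have := h4 x
    have := (h3 x).ne'
    field_simp
    linarith
  rw [h5]
  have h6 : Continuous (deriv (deriv w)) := by
    have h7 : ContDiff ℝ 1 (deriv w) := ((contDiff_succ_iff_deriv (n := 1)).1 h1).2.2
    exact h7.continuous_deriv le_rfl
  exact h1.continuous.sub (h6.div h1.continuous fun x => (h3 x).ne')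

/-- Positive steady states stay away from zero. -/
lemma IsBddPosSteadyState.half_le {g w : ℝ → ℝ} (hw : IsBddPosSteadyState g w) {m : ℝ}
    (hm : 0 < m) (hg : ∀ x, m ≤ g x) (x₀ : ℝ) : m / 2 ≤ w x₀ := by
  obtain ⟨h1, -, h3, h4⟩ := hw
  by_contra! hlt
  obtain ⟨k, hk, hk2⟩ : ∃ k : ℝ, 0 < k ∧ k ^ 2 = m / 4 :=
    ⟨√(m / 4), by positivity, Real.sq_sqrt (by positivity)⟩
  have hℓ : 0 < Real.pi / (2 * k) := by positivity
  set ℓ := Real.pi / (2 * k) with hℓdef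
  have hkℓ : k * ℓ = Real.pi / 2 := by rw [hℓdef]; field_simp
  obtain ⟨y, hy, hymax⟩ := (isCompact_Icc (a := x₀ - ℓ) (b := x₀ + ℓ)).exists_isMaxOn
    ⟨x₀, by constructor <;> linarith⟩ (f := fun x => Real.cos (k * (x - x₀)) / w x)
    (ContinuousOn.div (by fun_prop) h1.continuous.continuousOn fun x _ => (h3 x).ne')
  have hyp : ∀ x ∈ Icc (x₀ - ℓ) (x₀ + ℓ),
      Real.cos (k * (x - x₀)) / w x ≤ Real.cos (k * (y - x₀)) / w y := fun x hx => hymax hx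
  have hy0 := hyp x₀ (by constructor <;> linarith)
  simp only [sub_self, mul_zero, Real.cos_zero] at hy0
  set ρ := Real.cos (k * (y - x₀)) / w y with hρ
  have hρ0 : 0 < ρ := lt_of_lt_of_le (by have := h3 x₀; positivity) hy0
  have hcos : Real.cos (k * (y - x₀)) = ρ * w y := by rw [hρ]; field_simp [(h3 y).ne']
  have hcpos : 0 < Real.cos (k * (y - x₀)) := hcos ▸ mul_pos hρ0 (h3 y)
  have hyl : x₀ - ℓ < y := lt_of_le_of_ne hy.1 fun he => by
    rw [show k * (y - x₀) = -(k * ℓ) by rw [← he]; ring, hkℓ, Real.cos_neg, Real.cos_pi_div_two]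
      at hcpos
    exact lt_irrefl _ hcpos
  have hyr : y < x₀ + ℓ := lt_of_le_of_ne hy.2 fun he => by
    rw [show k * (y - x₀) = k * ℓ by rw [he]; ring, hkℓ, Real.cos_pi_div_two] at hcpos
    exact lt_irrefl _ hcpos
  have hw1 : ∀ x, HasDerivAt w (deriv w x) x := fun x =>
    (h1.differentiable (by norm_num) x).hasDerivAt
  have hw2 : HasDerivAt (deriv w) (deriv (deriv w) y) y :=
    ((((contDiff_succ_iff_deriv (n := 1)).1 h1).2.2).differentiable (by norm_num) y).hasDerivAt
  have hlin : ∀ x, HasDerivAt (fun x => k * (x - x₀)) k x := fun x => by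
    simpa using ((hasDerivAt_id' x).sub_const x₀).const_mul k
  have hsnd := second_deriv_nonpos_of_isLocalMax (x := y)
    (c := -(k ^ 2 * Real.cos (k * (y - x₀))) - ρ * deriv (deriv w) y)
    (f := fun x => Real.cos (k * (x - x₀)) - ρ * w x)
    (f' := fun x => -(k * Real.sin (k * (x - x₀))) - ρ * deriv w x) ?_ ?_ ?_
  · have hwy : w y < m / 2 := by
      have hwx := h3 x₀
      have h5 : 1 ≤ ρ * w x₀ := (div_le_iff₀ hwx).1 hy0
      have h6 := Real.cos_le_one (k * (y - x₀))
      have : ρ * w y ≤ ρ * w x₀ := by linarith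
      exact (le_of_mul_le_mul_left this hρ0).trans_lt hlt
    have h5 : deriv (deriv w) y = -(w y * (g y - w y)) := by linarith [h4 y]
    rw [hcos, h5, hk2] at hsnd
    have h6 : 0 < ρ * w y := mul_pos hρ0 (h3 y)
    have h7 : m / 2 < g y - w y := by linarith [hg y]
    nlinarith [mul_pos h6 hm, mul_lt_mul_of_pos_left h7 h6]
  · exact Eventually.of_forall fun x =>
      ((hlin x).cos.sub ((hw1 x).const_mul ρ)).congr_deriv (by ring)
  · exact (((hlin y).sin.const_mul k).neg.sub (hw2.const_mul ρ)).congr_deriv (by ring)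
  · filter_upwards [Icc_mem_nhds hyl hyr] with x hx
    have := hyp x hx
    rw [div_le_iff₀ (h3 x)] at this
    rw [hcos]
    linarith
namespace HeatFront

variable {u : ℝ → ℝ → ℝ} {h : ℝ → ℝ} {C F : ℝ}

/-- Linear lower bound behind the front, given a positive lower bound at distance `R`. -/
lemma exists_mul_le (H : HeatFront u h C F) {K δ R : ℝ} (hK : ∀ t, deriv h t ≤ K) (hδ : 0 < δ)
    (hfar : ∀ t, δ ≤ u (h t - R) t)
    (hsuper : ∀ t, ∀ x < h t, u x t ≤ δ →
      deriv (deriv fun y => u y t) x ≤ deriv (fun s => u x s) t) :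
    ∃ κ > 0, ∀ t x, h t - R ≤ x → x ≤ h t → κ * (h t - x) ≤ u x t := by
  have hC := H.C_nonneg
  have hK0 : 0 ≤ K := (H.deriv_front_nonneg 0).trans (hK 0)
  have hc := H.diff.continuous
  obtain ⟨α, hα⟩ : ∃ α, α = K + 1 := ⟨_, rfl⟩
  have hα0 : 0 < α := by linarith
  obtain ⟨η, hη, hηR⟩ : ∃ η > 0, η * (Real.exp (α * R) - 1) ≤ δ := by
    refine ⟨δ / Real.exp (α * R), by positivity, ?_⟩
    rw [div_mul_eq_mul_div, div_le_iff₀ (Real.exp_pos _)]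
    nlinarith [Real.exp_pos (α * R)]
  obtain ⟨c, hcdef⟩ : ∃ c, c = η * α / 2 := ⟨_, rfl⟩
  have hc0 : 0 < c := by rw [hcdef]; positivity
  refine ⟨η * α, by positivity, fun t x hx1 hx2 => ?_⟩
  have hWle : ∀ a, a ≤ R → η * (Real.exp (α * a) - 1) ≤ δ := fun a ha => by
    refine le_trans ?_ hηR
    gcongr
  have key := nonpos_of_no_positive_max (H.isCompact_strip R (t - (δ + C) / c) t)
    (Φ := fun p => η * (Real.exp (α * (h p.2 - p.1)) - 1) - u p.1 p.2 + c * (p.2 - t)) ?_ ?_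
    (x, t) ⟨⟨by simp; positivity, le_rfl⟩, hx1, hx2⟩
  · simp only [sub_self, mul_zero, add_zero] at key
    have := Real.add_one_le_exp (α * (h t - x))
    nlinarith
  · refine ((Continuous.continuousOn (by fun_prop)).sub (H.cont.mono fun p hp => hp.2.2)).add
      (by fun_prop)
  rintro ⟨y, s⟩ ⟨⟨h2, h3⟩, h4, h5⟩ hmax hpos
  simp only at h2 h3 h4 h5 hpos
  have hub := (abs_le.1 (H.bdd y s)).1
  have hW := hWle (h s - y) (by linarith)
  have hst : c * (s - t) ≤ 0 := mul_nonpos_of_nonneg_of_nonpos hc0.le (by linarith)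
  have h2' : t - (δ + C) / c < s := lt_of_le_of_ne h2 fun he => by
    rw [show c * (s - t) = -(δ + C) by rw [← he]; field_simp; ring] at hpos
    linarith
  have h4' : h s - R < y := lt_of_le_of_ne h4 fun he => by
    have := hfar s
    rw [he] at this
    linarith
  have h5' : y < h s := lt_of_le_of_ne h5 fun he => by
    rw [he, H.bdry s] at hpos
    simp at hpos
    linarith
  have hlin : ∀ z, HasDerivAt (fun z => α * (h s - z)) (-α) z := fun z =>
    (((hasDerivAt_id' z).const_sub (h s)).const_mul α).congr_deriv (by ring)
  obtain ⟨E, hE⟩ : ∃ E, E = Real.exp (α * (h s - y)) := ⟨_, rfl⟩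
  have hE1 : 1 ≤ E := by
    rw [hE]; exact Real.one_le_exp (mul_nonneg hα0.le (by linarith))
  have ht := deriv_nonneg_of_past_max (t := s) (((((((H.diff s).hasDerivAt.sub_const y).const_mul
    α).exp.sub_const 1).const_mul η).sub (H.reg_t s y h5').hasDerivAt).add
        (((hasDerivAt_id s).sub_const t).const_mul c)) (by
    filter_upwards [H.eventually_strip h2' h3 h4' h5'] with r hr using hmax (y, r) hr)
  have hxx := second_deriv_nonpos_of_isLocalMax (x := y)
    (c := η * α ^ 2 * E - deriv (deriv fun z => u z s) y)
    (f := fun z => η * (Real.exp (α * (h s - z)) - 1) - u z s + c * (s - t))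
    (f' := fun z => -(η * α * Real.exp (α * (h s - z))) - deriv (fun z => u z s) z) ?_ ?_ ?_
  · have h6 := hsuper s y h5' (by linarith)
    rw [← hE] at ht
    have h7 : E * (α * deriv h s) ≤ E * (α * K) := by
      gcongr
      exact hK s
    have h8 : η * (E * (α * deriv h s)) ≤ η * (E * (α * K)) := by gcongr
    have h9 : η * α * 1 ≤ η * α * E := by gcongr
    have h10 : 0 < η * α := by positivity
    have h11 : η * α ^ 2 * E = η * (E * (α * K)) + η * α * E := by rw [hα]; ring
    linarith
  · filter_upwards [H.eventually_hasDerivAt h5'] with z hz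
    exact ((((((hlin z).exp.sub_const 1).const_mul η).sub hz)).add_const
      (c * (s - t))).congr_deriv (by ring)
  · exact (((hlin y).exp.const_mul (η * α)).neg.sub (H.reg_xx s y h5').hasDerivAt).congr_deriv
      (by rw [hE]; ring)
  · filter_upwards [eventually_gt_nhds h4', eventually_lt_nhds h5'] with z h6 h7
    exact hmax (z, s) ⟨⟨h2, h3⟩, h6.le, h7.le⟩

lemma neg_le_deriv_front (H : HeatFront u h C F) {t : ℝ} :
    -(2 * (C + F + 1)) ≤ deriv (fun y => u y t) (h t) := by
  by_cases hd : DifferentiableAt ℝ (fun y => u y t) (h t)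
  · have := deriv_nonneg_of_past_max (hd.hasDerivAt.sub
      (((hasDerivAt_id' (h t)).const_sub (h t)).const_mul (2 * (C + F + 1)))) (by
      filter_upwards [self_mem_nhdsWithin] with x hx
      have := H.le_linear (mem_Iio.1 hx).le
      simp [H.bdry]
      linarith)
    linarith
  · rw [deriv_zero_of_not_differentiableAt hd]
    linarith [H.C_nonneg, H.F_nonneg]

lemma deriv_front_le_neg (H : HeatFront u h C F) {t κ R : ℝ} (hR : 0 < R)
    (hκ : ∀ x, h t - R ≤ x → x ≤ h t → κ * (h t - x) ≤ u x t)
    (hd : DifferentiableAt ℝ (fun y => u y t) (h t)) :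
    deriv (fun y => u y t) (h t) ≤ -κ := by
  have := deriv_nonneg_of_past_max ((((hasDerivAt_id' (h t)).const_sub (h t)).const_mul κ).sub
    hd.hasDerivAt) (by
    filter_upwards [self_mem_nhdsWithin, (eventually_gt_nhds
      (show h t - R < h t by linarith)).filter_mono nhdsWithin_le_nhds] with x hx hx'
    have := hκ x hx'.le (mem_Iio.1 hx).le
    simp [H.bdry]
    linarith)
  linarith

end HeatFront

lemma IsAPSemiWave.heatFront {μ G C : ℝ} {g ustar : ℝ → ℝ} {u : ℝ → ℝ → ℝ} {h : ℝ → ℝ}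
    (hsw : IsAPSemiWave μ g ustar u h) (hC : ∀ x t, |u x t| ≤ C) (hG : ∀ x, |g x| ≤ G) :
    HeatFront u h C (C * (G + C)) where
  mono := hsw.mono.monotone
  diff t := hsw.sol.h_diff t trivial
  cont := by simpa using hsw.sol.u_cont
  bdd := hC
  bdry t := hsw.sol.bdry t trivial
  reg_x t x hx := (hsw.sol.u_reg_x t trivial x hx).1
  reg_xx t x hx := (hsw.sol.u_reg_x t trivial x hx).2
  reg_t t x hx := hsw.sol.u_reg_t t trivial x hx
  pde t x hx := by
    rw [hsw.sol.pde t trivial x hx, add_sub_cancel_left, abs_mul]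
    have hC0 := (abs_nonneg _).trans (hC x t)
    gcongr
    · exact hC x t
    · exact (abs_sub _ _).trans (add_le_add (hG x) (hC x t))

lemma IsAPSemiWave.profile_front {μ : ℝ} {g ustar : ℝ → ℝ} {u : ℝ → ℝ → ℝ} {h : ℝ → ℝ}
    (hsw : IsAPSemiWave μ g ustar u h) (ξ t : ℝ) : profile u h ξ (h t) = u (ξ + h t) t := by
  rw [profile, Function.leftInverse_invFun hsw.mono.injective]

/-- The front speed is bounded below, provided the gradient at the front is bounded away from `0`
whenever it exists. -/
lemma le_deriv_of_gap {h : ℝ → ℝ} {q : ℝ} (hq : 0 < q) (hmono : StrictMono h)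
    (hd : Differentiable ℝ h) (hc : Continuous (deriv h))
    (hgap : ∀ t, deriv h t = 0 ∨ q ≤ deriv h t) (t : ℝ) : q ≤ deriv h t := by
  refine (hgap t).resolve_left fun h0 => ?_
  obtain ⟨t₁, ht₁⟩ : ∃ t₁, deriv h t₁ ≠ 0 := by
    by_contra! hall
    exact (hmono one_pos).ne (is_const_of_deriv_eq_zero hd hall 0 1)
  have h1 := (hgap t₁).resolve_left ht₁
  obtain ⟨s, hs⟩ := mem_range_of_exists_le_of_exists_ge hc (c := q / 2)
    ⟨t, by rw [h0]; positivity⟩ ⟨t₁, by linarith⟩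
  rcases hgap s with h2 | h2 <;> linarith

theorem semi_wave_speed_almost_periodic_and_average_speed (μ : ℝ) (hμ : 0 < μ)
    (g ustar : ℝ → ℝ) (hg : BohrAlmostPeriodic g)
    (hginf : ∃ m > (0 : ℝ), ∀ x : ℝ, m ≤ g x)
    (hstar : IsBddPosSteadyState g ustar)
    (utld : ℝ → ℝ → ℝ) (htld : ℝ → ℝ)
    (hsw : IsAPSemiWave μ g ustar utld htld)
    (f : ℝ → ℝ)
    (hf : ∀ τ : ℝ, f τ = -μ * deriv (fun ξ => profile utld htld ξ τ) 0) :
    (∀ t : ℝ, deriv htld t = f (htld t)) ∧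
      BohrAlmostPeriodic f ∧
      (∃ m > (0 : ℝ), ∀ τ : ℝ, m ≤ f τ) ∧
      (∃ M : ℝ, ∀ τ : ℝ, f τ ≤ M) ∧
      ∃ c > (0 : ℝ), ∀ ε > (0 : ℝ), ∃ D : ℝ, ∀ r s : ℝ, D ≤ s - r →
        |(s - r) / (∫ τ in r..s, (f τ)⁻¹) - c| < ε := by
  obtain ⟨m, hm, hgm⟩ := hginf
  obtain ⟨C, hC⟩ := hsw.bdd
  obtain ⟨G, hG⟩ := hg.abs_bounded hstar.continuous_coeff
  have H := hsw.heatFront hC hG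
  have hC0 := H.C_nonneg
  have hF0 := H.F_nonneg
  set F := C * (G + C)
  have hcont := H.diff.continuous
  have hstefan : ∀ t, deriv htld t = -μ * deriv (fun y => utld y t) (htld t) :=
    fun t => hsw.sol.stefan t trivial
  have hspeed : ∀ t, deriv htld t = f (htld t) := fun t => by
    rw [hstefan, hf]
    simp only [hsw.profile_front]
    rw [deriv_comp_add_const (fun y => utld y t), zero_add]
  have hsurj : Function.Surjective htld := hcont.surjective hsw.tendsto_top hsw.tendsto_bot
  set K := μ * (2 * (C + F + 1)) with hKdef
  have hK : ∀ t, deriv htld t ≤ K := fun t => by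
    rw [hstefan, hKdef]
    nlinarith [H.neg_le_deriv_front (t := t)]
  obtain ⟨X, hX⟩ := hsw.connects (m / 4) (by positivity)
  obtain ⟨R, hR, hRX⟩ : ∃ R : ℝ, 0 < R ∧ -R ≤ X :=
    ⟨|X| + 1, by positivity, by linarith [neg_abs_le X]⟩
  obtain ⟨κ, hκ, hκu⟩ := H.exists_mul_le hK (δ := m / 4) (R := R) (by positivity) (fun t => by
    have h1 := hX (-R) hRX (htld t)
    rw [hsw.profile_front, neg_add_eq_sub] at h1
    linarith [(abs_lt.1 h1).1, hstar.half_le hm hgm (htld t - R)]) (fun t x hx hxm => by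
    rw [hsw.sol.pde t trivial x hx]
    have := mul_nonneg (hsw.pos t x hx).le (show 0 ≤ g x - utld x t by linarith [hgm x])
    linarith)
  have hlow : ∀ t, μ * κ ≤ deriv htld t := by
    refine le_deriv_of_gap (by positivity) hsw.mono H.diff
      (continuousOn_univ.1 hsw.sol.h_deriv_cont) fun t => ?_
    by_cases hd : DifferentiableAt ℝ (fun y => utld y t) (htld t)
    · right
      rw [hstefan]
      nlinarith [H.deriv_front_le_neg hR (hκu t) hd]
    · left
      rw [hstefan, deriv_zero_of_not_differentiableAt hd, mul_zero]
  have hdiff : ∀ t, DifferentiableAt ℝ (fun y => utld y t) (htld t) := fun t => by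
    by_contra hd
    have h1 := hlow t
    rw [hstefan, deriv_zero_of_not_differentiableAt hd, mul_zero] at h1
    have : 0 < μ * κ := by positivity
    linarith
  have hfm : ∀ τ, μ * κ ≤ f τ := fun τ => by
    obtain ⟨t, rfl⟩ := hsurj τ
    exact hspeed t ▸ hlow t
  have hfM : ∀ τ, f τ ≤ K := fun τ => by
    obtain ⟨t, rfl⟩ := hsurj τ
    exact hspeed t ▸ hK t
  have hm0 : 0 < μ * κ := by positivity
  have hK0 : 0 < K := hm0.trans_le ((hfm 0).trans (hfM 0))
  have hfcont : Continuous f := by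
    have h1 : f = deriv htld ∘ (hsw.mono.orderIsoOfSurjective htld hsurj).symm := by
      funext τ
      have := (hsw.mono.orderIsoOfSurjective htld hsurj).apply_symm_apply τ
      rw [StrictMono.coe_orderIsoOfSurjective] at this
      rw [Function.comp_apply, hspeed, this]
    rw [h1]
    exact (continuousOn_univ.1 hsw.sol.h_deriv_cont).comp (OrderIso.continuous _)
  have hfap : BohrAlmostPeriodic f := by
    intro ε hε
    obtain ⟨Q, hQ⟩ : ∃ Q, Q = 6 * (C + F + 1) + 4 * (C + F + 1) * K := ⟨_, rfl⟩
    have hQ0 : 0 < Q := by rw [hQ]; positivity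
    obtain ⟨a, ha0, ha1, haε⟩ : ∃ a : ℝ, 0 < a ∧ a ≤ 1 ∧ μ * (Q * a) ≤ ε / 4 := by
      refine ⟨min 1 (ε / (4 * μ * Q)), by positivity, min_le_left _ _, ?_⟩
      calc _ ≤ μ * (Q * (ε / (4 * μ * Q))) := by gcongr; exact min_le_right _ _
        _ = _ := by field_simp
    have happrox : ∀ τ, |f τ * a - μ * profile utld htld (-a) τ| ≤ ε / 4 * a := fun τ => by
      obtain ⟨t, rfl⟩ := hsurj τ
      have h1 := H.abs_add_mul_deriv_le hK ⟨ha0.le, ha1⟩ (hdiff t)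
      rw [← hQ] at h1
      rw [← hspeed, hstefan, hsw.profile_front, neg_add_eq_sub, ← abs_neg]
      calc _ = |μ * (utld (htld t - a) t + deriv (fun y => utld y t) (htld t) * a)| := by
            congr 1; ring
        _ ≤ μ * (Q * a * a) := by rw [abs_mul, abs_of_pos hμ]; gcongr
        _ = μ * (Q * a) * a := by ring
        _ ≤ _ := by gcongr
    obtain ⟨L, hL, hs⟩ := hsw.almost_periodic (ε / 4 * a / μ) (by positivity)
    refine ⟨L, hL, fun t => ?_⟩
    obtain ⟨s, hst, hsv⟩ := hs t
    refine ⟨s, hst, fun x => ?_⟩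
    have h1 := abs_le.1 (happrox (x + s))
    have h2 := abs_le.1 (happrox x)
    have h3 := hsv (-a) (by linarith) x
    rw [lt_div_iff₀ hμ] at h3
    have h4 := abs_lt.1 ((abs_mul _ μ).trans_lt ((abs_of_pos hμ).symm ▸ h3))
    have h5 : |(f (x + s) - f x) * a| < ε * a := abs_lt.2 ⟨by nlinarith, by nlinarith⟩
    rw [abs_mul, abs_of_pos ha0] at h5
    exact lt_of_mul_lt_mul_right h5 ha0.le
  refine ⟨hspeed, hfap, ⟨_, hm0, hfm⟩, ⟨_, hfM⟩, ?_⟩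
  have hicont : Continuous fun τ => (f τ)⁻¹ := hfcont.inv₀ fun τ => (hm0.trans_le (hfm τ)).ne'
  obtain ⟨A, hA⟩ := (hfap.inv hm0 hfm).exists_mean hicont
  have hA0 : 0 < A := by
    obtain ⟨D, hD, hAD⟩ := hA (K⁻¹ / 2) (by positivity)
    have h1 := hAD 0 D (by simp)
    have h2 : D * K⁻¹ ≤ ∫ τ in (0 : ℝ)..D, (f τ)⁻¹ := by
      have := intervalIntegral.integral_mono_on (μ := MeasureTheory.volume) hD.le
        (intervalIntegrable_const (c := K⁻¹)) (hicont.intervalIntegrable 0 D)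
        fun τ _ => inv_anti₀ (hm0.trans_le (hfm τ)) (hfM τ)
      simpa using this
    have h3 : K⁻¹ ≤ (∫ τ in (0 : ℝ)..D, (f τ)⁻¹) / (D - 0) := by
      rw [sub_zero, le_div_iff₀ hD]
      linarith
    have : 0 < K⁻¹ := by positivity
    linarith [(abs_le.1 h1).2]
  refine ⟨A⁻¹, by positivity, fun ε hε => ?_⟩
  obtain ⟨η, hη, hinv⟩ := Metric.continuousAt_iff.1 (continuousAt_inv₀ hA0.ne') ε hε
  obtain ⟨D, hD, hAD⟩ := hA (η / 2) (by positivity)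
  refine ⟨D, fun r s hrs => ?_⟩
  have h1 := hinv (x := (∫ τ in r..s, (f τ)⁻¹) / (s - r)) (by
    rw [Real.dist_eq]
    linarith [hAD r s hrs])
  rwa [Real.dist_eq, inv_div] at h1
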